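/- arXiv:0910.4213 — 6 statements merged into one kernel-verified Lean document; each statement's English description precedes it below -/
import Mathlib

section
/- Let m,d ≥ 1, let g:ℝᵐ×ℝ^{m×d}→ℝᵐ be a function and C>0 a constant. Suppose that for all y,y′∈ℝᵐ and z,z′∈ℝ^{m×d}: −4⟨y⁻, g(y⁺+y′,z) − g(y′,z′)⟩ ≤ 2·Σ_{k=1}^m 1_{{y_k<0}}|z_k−z′_k|² + C|y⁻|². Then for every k∈{1,…,m}, every y′∈ℝᵐ and all z,z′∈ℝ^{m×d} with z_k = z′_k, one has g_k(y′,z) = g_k(y′,z′); that is, the k-th component of g depends on z only through the k-th row z_k. -/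
theorem component_depends_only_on_own_row (m d : ℕ) (hm : 1 ≤ m) (hd : 1 ≤ d)
    (g : (Fin m → ℝ) → (Fin m → Fin d → ℝ) → (Fin m → ℝ)) (C : ℝ) (hC : 0 < C)
    (H : ∀ (y y' : Fin m → ℝ) (z z' : Fin m → Fin d → ℝ),
      -4 * (∑ k, max (-(y k)) 0 *
          (g (fun i => max (y i) 0 + y' i) z k - g y' z' k)) ≤
        2 * (∑ k, (if y k < 0 then (1 : ℝ) else 0) * (∑ j, (z k j - z' k j) ^ 2)) +
          C * (∑ k, (max (-(y k)) 0) ^ 2)) :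
    ∀ (k : Fin m) (y' : Fin m → ℝ) (z z' : Fin m → Fin d → ℝ),
      z k = z' k → g y' z k = g y' z' k := by
  have le : ∀ (k : Fin m) (y' : Fin m → ℝ) (z z' : Fin m → Fin d → ℝ),
      z k = z' k → g y' z' k ≤ g y' z k := by
    intro k y' z z' hz
    by_contra! hlt
    -- Test the hypothesis with `y = -t e_k`, where `t = (g y' z' k - g y' z k) / C`.
    obtain ⟨t, ht⟩ : ∃ t, t = (g y' z' k - g y' z k) / C := ⟨_, rfl⟩
    have htpos : 0 < t := ht ▸ div_pos (sub_pos.2 hlt) hC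
    have hCt : C * t = g y' z' k - g y' z k := by
      rw [ht]
      field_simp
    have hneg : ∀ i, max (-(Pi.single k (-t) : Fin m → ℝ) i) 0 = if i = k then t else 0 := by
      intro i
      by_cases hi : i = k
      · subst hi
        simp [htpos.le]
      · simp [hi]
    have hpos : (fun i => max ((Pi.single k (-t) : Fin m → ℝ) i) 0 + y' i) = y' := by
      funext i
      by_cases hi : i = k
      · subst hi
        simp [htpos.le]
      · simp [hi]
    have hrow : ∑ i, (if (Pi.single k (-t) : Fin m → ℝ) i < 0 then (1 : ℝ) else 0) *
        (∑ j, (z i j - z' i j) ^ 2) = 0 := by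
      refine Finset.sum_eq_zero fun i _ => ?_
      by_cases hi : i = k
      · subst hi
        simp [hz]
      · simp [hi]
    have h := H (Pi.single k (-t)) y' z z'
    rw [hrow, hpos] at h
    simp only [hneg, ite_mul, zero_mul, ite_pow, Finset.sum_ite_eq', Finset.mem_univ, if_true,
      ne_eq, OfNat.ofNat_ne_zero, not_false_eq_true, zero_pow] at h
    nlinarith [mul_pos htpos (mul_pos hC htpos)]
  exact fun k y' z z' hz => le_antisymm (le k y' z' z hz.symm) (le k y' z z' hz)
end

section
/- Let m,d ≥ 1, let g₁,g₂:ℝᵐ×ℝ^{m×d}→ℝᵐ be functions and C>0 a constant. Suppose that for all y,y′∈ℝᵐ and z,z′∈ℝ^{m×d}: −4⟨y⁻, g₁(y⁺+y′,z) − g₂(y′,z′)⟩ ≤ 2·Σ_{k=1}^m 1_{{y_k<0}}|z_k−z′_k|² + C|y⁻|². Then for every k∈{1,…,m}, every y′∈ℝᵐ, every z∈ℝ^{m×d}, and every δy∈ℝᵐ with δy ≥ 0 and (δy)_k = 0, one has g₁,ₖ(δy+y′, z) ≥ g₂,ₖ(y′, z). -/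
theorem quasi_monotonicity_of_bsvp_condition (m d : ℕ) (hm : 1 ≤ m) (hd : 1 ≤ d)
    (g₁ g₂ : (Fin m → ℝ) → (Fin m → Fin d → ℝ) → (Fin m → ℝ)) (C : ℝ) (hC : 0 < C)
    (H : ∀ (y y' : Fin m → ℝ) (z z' : Fin m → Fin d → ℝ),
      -4 * (∑ k, max (-(y k)) 0 *
          (g₁ (fun i => max (y i) 0 + y' i) z k - g₂ y' z' k)) ≤
        2 * (∑ k, (if y k < 0 then (1 : ℝ) else 0) * (∑ j, (z k j - z' k j) ^ 2)) +
          C * (∑ k, (max (-(y k)) 0) ^ 2)) :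
    ∀ (k : Fin m) (y' : Fin m → ℝ) (z : Fin m → Fin d → ℝ) (δy : Fin m → ℝ),
      (∀ i, 0 ≤ δy i) → δy k = 0 →
      g₂ y' z k ≤ g₁ (fun i => δy i + y' i) z k := by
  intro k y' z δy hδ hk
  by_contra! hlt
  set Δ := g₁ (fun i => δy i + y' i) z k - g₂ y' z k with hΔ
  have hΔneg : Δ < 0 := sub_neg.mpr hlt
  -- Test the hypothesis at `δy` with its vanishing `k`-th entry replaced by `-ε`.
  set ε := -Δ / C with hε
  have hεpos : 0 < ε := div_pos (neg_pos.mpr hΔneg) hC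
  have hCε : C * ε = -Δ := by rw [hε]; field_simp
  have hpos : (fun i => max (Function.update δy k (-ε) i) 0 + y' i) =
      fun i => δy i + y' i := by
    funext i
    rcases eq_or_ne i k with rfl | hi
    · simp [hk, hεpos.le]
    · simp [hi, hδ i]
  have hneg : ∀ i, max (-(Function.update δy k (-ε) i)) 0 = if i = k then ε else 0 := by
    intro i
    rcases eq_or_ne i k with rfl | hi
    · simp [hεpos.le]
    · simp [hi, hδ i]
  have hmain := H (Function.update δy k (-ε)) y' z z
  rw [hpos] at hmain
  simp only [hneg, ite_mul, zero_mul, ite_pow, sub_self, ne_eq, OfNat.ofNat_ne_zero,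
    not_false_eq_true, zero_pow, Finset.sum_ite_eq', Finset.mem_univ, if_true,
    Finset.sum_const_zero, mul_zero, zero_add] at hmain
  rw [← hΔ] at hmain
  nlinarith [mul_pos hεpos (neg_pos.mpr hΔneg)]
end

section
/- Let m,d ≥ 1 and L ≥ 0, and let g₁,g₂:ℝᵐ×ℝ^{m×d}→ℝᵐ be L-Lipschitz functions (with respect to the Euclidean norms). Suppose that for each k∈{1,…,m} and j=1,2, the component g_{j,k}(y,z) depends on z only through the k-th row z_k (i.e. g_{j,k}(y,z)=g_{j,k}(y,z′) whenever z_k=z′_k), and that for every k, every y′∈ℝᵐ, every z∈ℝ^{m×d}, and every δy∈ℝᵐ with δy ≥ 0 and (δy)_k = 0, one has g₁,ₖ(δy+y′, z) ≥ g₂,ₖ(y′, z). Then, with C := 2L², for all y,y′∈ℝᵐ and z,z′∈ℝ^{m×d}: −4⟨y⁻, g₁(y⁺+y′,z) − g₂(y′,z′)⟩ ≤ 2·Σ_{k=1}^m 1_{{y_k<0}}|z_k−z′_k|² + C|y⁻|². -/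
/-- If a map is Lipschitz in `z` for the Euclidean norms and its `k`-th component depends on `z` only
through the `k`-th row, then that component is Lipschitz in the `k`-th row. -/
theorem abs_sub_le_of_lipschitz_of_row_dependence {m d : ℕ} {L : ℝ}
    {f : (Fin m → Fin d → ℝ) → (Fin m → ℝ)}
    (hLip : ∀ z z' : Fin m → Fin d → ℝ,
      Real.sqrt (∑ k, (f z k - f z' k) ^ 2) ≤
        L * Real.sqrt (∑ k, ∑ j, (z k j - z' k j) ^ 2))
    {k : Fin m} (hdep : ∀ z z' : Fin m → Fin d → ℝ, z k = z' k → f z k = f z' k)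
    (z z' : Fin m → Fin d → ℝ) :
    |f z k - f z' k| ≤ L * Real.sqrt (∑ j, (z k j - z' k j) ^ 2) := by
  have hrow : f z k = f (Function.update z' k (z k)) k := hdep _ _ (by simp)
  have hsum : ∑ i, ∑ j, (Function.update z' k (z k) i j - z' i j) ^ 2 =
      ∑ j, (z k j - z' k j) ^ 2 := by
    rw [Finset.sum_eq_single k]
    · simp
    · intro i _ hi
      simp [Function.update_of_ne hi]
    · simp
  rw [hrow, ← hsum]
  refine le_trans ?_ (hLip _ _)
  refine Real.abs_le_sqrt ?_
  exact Finset.single_le_sum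
    (f := fun i => (f (Function.update z' k (z k)) i - f z' i) ^ 2)
    (fun i _ => sq_nonneg _) (Finset.mem_univ k)

theorem bsvp_condition_of_structure (m d : ℕ) (hm : 1 ≤ m) (hd : 1 ≤ d) (L : ℝ) (hL : 0 ≤ L)
    (g₁ g₂ : (Fin m → ℝ) → (Fin m → Fin d → ℝ) → (Fin m → ℝ))
    (hLip₁ : ∀ (y y' : Fin m → ℝ) (z z' : Fin m → Fin d → ℝ),
      Real.sqrt (∑ k, (g₁ y z k - g₁ y' z' k) ^ 2) ≤
        L * (Real.sqrt (∑ k, (y k - y' k) ^ 2) +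
             Real.sqrt (∑ k, ∑ j, (z k j - z' k j) ^ 2)))
    (hLip₂ : ∀ (y y' : Fin m → ℝ) (z z' : Fin m → Fin d → ℝ),
      Real.sqrt (∑ k, (g₂ y z k - g₂ y' z' k) ^ 2) ≤
        L * (Real.sqrt (∑ k, (y k - y' k) ^ 2) +
             Real.sqrt (∑ k, ∑ j, (z k j - z' k j) ^ 2)))
    (hdep₁ : ∀ (k : Fin m) (y : Fin m → ℝ) (z z' : Fin m → Fin d → ℝ),
      z k = z' k → g₁ y z k = g₁ y z' k)
    (hdep₂ : ∀ (k : Fin m) (y : Fin m → ℝ) (z z' : Fin m → Fin d → ℝ),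
      z k = z' k → g₂ y z k = g₂ y z' k)
    (hmono : ∀ (k : Fin m) (y' : Fin m → ℝ) (z : Fin m → Fin d → ℝ) (δy : Fin m → ℝ),
      (∀ i, 0 ≤ δy i) → δy k = 0 →
      g₂ y' z k ≤ g₁ (fun i => δy i + y' i) z k) :
    ∀ (y y' : Fin m → ℝ) (z z' : Fin m → Fin d → ℝ),
      -4 * (∑ k, max (-(y k)) 0 *
          (g₁ (fun i => max (y i) 0 + y' i) z k - g₂ y' z' k)) ≤
        2 * (∑ k, (if y k < 0 then (1 : ℝ) else 0) * (∑ j, (z k j - z' k j) ^ 2)) +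
          (2 * L ^ 2) * (∑ k, (max (-(y k)) 0) ^ 2) := by
  intro y y' z z'
  rw [Finset.mul_sum, Finset.mul_sum, Finset.mul_sum, ← Finset.sum_add_distrib]
  refine Finset.sum_le_sum fun k _ => ?_
  by_cases hk : y k < 0
  · have hcomp := hmono k y' z (fun i => max (y i) 0) (fun i => le_max_right _ _)
      (max_eq_right hk.le)
    have hrow := abs_sub_le_of_lipschitz_of_row_dependence
      (fun z z' => by simpa using hLip₂ y' y' z z') (hdep₂ k y') z z'
    have hlow := (abs_le.mp hrow).1
    have hsq : Real.sqrt (∑ j, (z k j - z' k j) ^ 2) ^ 2 = ∑ j, (z k j - z' k j) ^ 2 :=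
      Real.sq_sqrt (Finset.sum_nonneg fun j _ => sq_nonneg _)
    rw [if_pos hk, max_eq_left (by linarith : (0 : ℝ) ≤ -y k), ← hsq]
    set s := Real.sqrt (∑ j, (z k j - z' k j) ^ 2)
    have hmul : -y k * -(L * s) ≤
        -y k * (g₁ (fun i => max (y i) 0 + y' i) z k - g₂ y' z' k) :=
      mul_le_mul_of_nonneg_left (by linarith) (by linarith)
    nlinarith [sq_nonneg (s - L * -y k)]
  · rw [if_neg hk, max_eq_right (by linarith : -y k ≤ 0)]
    simp
end

section
/- Let m,d ≥ 1 and L ≥ 0, and let F:ℝᵐ×ℝ^{m×d}×ℝᵐ→ℝᵐ be an L-Lipschitz function (with respect to the Euclidean norms in all variables). Then the following are equivalent: (a) there exists a constant C>0 such that for all y,y′∈ℝᵐ, z,z′∈ℝ^{m×d}, and θ⁽¹⁾,θ⁽²⁾∈ℝᵐ with θ⁽¹⁾ ≥ θ⁽²⁾: −4⟨y⁻, F(y⁺+y′,z,θ⁽¹⁾) − F(y′,z′,θ⁽²⁾)⟩ ≤ 2·Σ_{k=1}^m 1_{{y_k<0}}|z_k−z′_k|² + C|y⁻|²; (b) for every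 k∈{1,…,m}: the component F_k(y,z,θ) depends on z only through the k-th row z_k, and F_k(δy+y′, z, θ⁽¹⁾) ≥ F_k(y′, z, θ⁽²⁾) for all y′∈ℝᵐ, z∈ℝ^{m×d}, all δy∈ℝᵐ with δy ≥ 0 and (δy)_k = 0, and all θ⁽¹⁾,θ⁽²⁾∈ℝᵐ with θ⁽¹⁾ ≥ θ⁽²⁾. -/
/-- A real number bounded above by every positive multiple of a constant is nonpositive. -/
lemma nonpos_of_forall_pos_le_mul {a c : ℝ} (h : ∀ ε > 0, a ≤ c * ε) : a ≤ 0 := by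
  by_contra! ha
  have hc : 0 < |c| + 1 := by positivity
  have h1 := h (a / (2 * (|c| + 1))) (by positivity)
  have h2 : c * (a / (2 * (|c| + 1))) ≤ (|c| + 1) * (a / (2 * (|c| + 1))) := by
    gcongr
    linarith [le_abs_self c]
  have h3 : (|c| + 1) * (a / (2 * (|c| + 1))) = a / 2 := by field_simp
  linarith

theorem bsvp_condition_iff_structure (m d : ℕ) (hm : 1 ≤ m) (hd : 1 ≤ d) (L : ℝ) (hL : 0 ≤ L)
    (F : (Fin m → ℝ) → (Fin m → Fin d → ℝ) → (Fin m → ℝ) → (Fin m → ℝ))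
    (hLip : ∀ (y y' : Fin m → ℝ) (z z' : Fin m → Fin d → ℝ) (θ θ' : Fin m → ℝ),
      Real.sqrt (∑ k, (F y z θ k - F y' z' θ' k) ^ 2) ≤
        L * (Real.sqrt (∑ k, (y k - y' k) ^ 2) +
             Real.sqrt (∑ k, ∑ j, (z k j - z' k j) ^ 2) +
             Real.sqrt (∑ k, (θ k - θ' k) ^ 2))) :
    (∃ C : ℝ, 0 < C ∧
      ∀ (y y' : Fin m → ℝ) (z z' : Fin m → Fin d → ℝ) (θ₁ θ₂ : Fin m → ℝ),
        (∀ i, θ₂ i ≤ θ₁ i) →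
        -4 * (∑ k, max (-(y k)) 0 *
            (F (fun i => max (y i) 0 + y' i) z θ₁ k - F y' z' θ₂ k)) ≤
          2 * (∑ k, (if y k < 0 then (1 : ℝ) else 0) * (∑ j, (z k j - z' k j) ^ 2)) +
            C * (∑ k, (max (-(y k)) 0) ^ 2)) ↔
    (∀ k : Fin m,
      (∀ (y : Fin m → ℝ) (z z' : Fin m → Fin d → ℝ) (θ : Fin m → ℝ),
        z k = z' k → F y z θ k = F y z' θ k) ∧
      (∀ (y' : Fin m → ℝ) (z : Fin m → Fin d → ℝ) (δy : Fin m → ℝ) (θ₁ θ₂ : Fin m → ℝ),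
        (∀ i, 0 ≤ δy i) → δy k = 0 → (∀ i, θ₂ i ≤ θ₁ i) →
        F y' z θ₂ k ≤ F (fun i => δy i + y' i) z θ₁ k)) := by
  constructor
  · rintro ⟨C, -, h⟩ k
    have key : ∀ (y' : Fin m → ℝ) (z z' : Fin m → Fin d → ℝ) (δy θ₁ θ₂ : Fin m → ℝ),
        (∀ i, 0 ≤ δy i) → δy k = 0 → (∀ i, θ₂ i ≤ θ₁ i) → z k = z' k →
        F y' z' θ₂ k ≤ F (fun i => δy i + y' i) z θ₁ k := by
      intro y' z z' δy θ₁ θ₂ hδ hk hθ hz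
      refine sub_nonpos.1 (nonpos_of_forall_pos_le_mul (c := C / 4) fun ε hε => ?_)
      have h1 := h (Function.update δy k (-ε)) y' z z' θ₁ θ₂ hθ
      have hpos : (fun i => max (Function.update δy k (-ε) i) 0 + y' i)
          = fun i => δy i + y' i := by
        funext i
        rcases eq_or_ne i k with rfl | hi
        · simp [hk, hε.le]
        · simp [hi, hδ i]
      have hneg : ∀ i, i ≠ k → max (-(Function.update δy k (-ε) i)) 0 = 0 := by
        intro i hi
        simp [hi, hδ i]
      have hnegk : max (-(Function.update δy k (-ε) k)) 0 = ε := by simp [hε.le]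
      rw [hpos, Finset.sum_eq_single k (fun i _ hi => by rw [hneg i hi, zero_mul]) (by simp),
        Finset.sum_eq_single k
          (fun i _ hi => by simp [hi, (hδ i).not_gt]) (by simp),
        Finset.sum_eq_single k (fun i _ hi => by rw [hneg i hi]; simp) (by simp), hnegk] at h1
      simp only [hz, sub_self, ne_eq, OfNat.ofNat_ne_zero, not_false_eq_true, zero_pow,
        Finset.sum_const_zero, mul_zero, zero_add] at h1
      refine le_of_mul_le_mul_left ?_ hε
      linarith
    refine ⟨fun y z z' θ hz => le_antisymm ?_ ?_, fun y' z δy θ₁ θ₂ hδ hk hθ =>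
      key y' z z δy θ₁ θ₂ hδ hk hθ rfl⟩
    · simpa using key y z' z 0 θ θ (by simp) rfl (fun _ => le_rfl) hz.symm
    · simpa using key y z z' 0 θ θ (by simp) rfl (fun _ => le_rfl) hz
  · intro h
    refine ⟨2 * L ^ 2 + 1, by positivity, fun y y' z z' θ₁ θ₂ hθ => ?_⟩
    simp only [Finset.mul_sum (s := (Finset.univ : Finset (Fin m))), ← Finset.sum_add_distrib]
    refine Finset.sum_le_sum fun k _ => ?_
    by_cases hy : y k < 0
    · have hyk : max (-(y k)) 0 = -y k := max_eq_left (by linarith)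
      have hmono := (h k).2 y' z (fun i => max (y i) 0) θ₁ θ₂ (fun i => le_max_right _ _)
        (max_eq_right hy.le) hθ
      have hrow := (h k).1 y' z (Function.update z' k (z k)) θ₂ (by simp)
      have hlip := hLip y' y' z' (Function.update z' k (z k)) θ₂ θ₂
      have hcomp : F y' z' θ₂ k - F y' (Function.update z' k (z k)) θ₂ k ≤
          Real.sqrt (∑ i, (F y' z' θ₂ i - F y' (Function.update z' k (z k)) θ₂ i) ^ 2) :=
        Real.le_sqrt_of_sq_le (Finset.single_le_sum
          (f := fun i => (F y' z' θ₂ i - F y' (Function.update z' k (z k)) θ₂ i) ^ 2)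
          (fun i _ => sq_nonneg _) (Finset.mem_univ k))
      have hsum : ∑ i, ∑ j, (z' i j - Function.update z' k (z k) i j) ^ 2
          = ∑ j, (z k j - z' k j) ^ 2 := by
        rw [Finset.sum_eq_single k (fun i _ hi => by simp [hi]) (by simp)]
        refine Finset.sum_congr rfl fun j _ => ?_
        rw [Function.update_self]
        ring
      rw [hsum] at hlip
      simp only [sub_self, ne_eq, OfNat.ofNat_ne_zero, not_false_eq_true, zero_pow,
        Finset.sum_const_zero, Real.sqrt_zero, zero_add, add_zero] at hlip
      have hsq := Real.sq_sqrt (Finset.sum_nonneg fun j (_ : j ∈ Finset.univ) =>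
        sq_nonneg (z k j - z' k j))
      rw [hyk, if_pos hy, one_mul, ← hsq]
      set r := Real.sqrt (∑ j, (z k j - z' k j) ^ 2)
      have hdiff : F y' z' θ₂ k - F (fun i => max (y i) 0 + y' i) z θ₁ k ≤ L * r := by linarith
      have hmul := mul_le_mul_of_nonneg_left hdiff (by linarith : 0 ≤ -y k)
      nlinarith [sq_nonneg (r - L * -y k), sq_nonneg (y k)]
    · have hyk : max (-(y k)) 0 = 0 := max_eq_right (by linarith)
      simp [hyk, hy]
end

section
/- Let d ≥ 1 and L ≥ 0, and let g₁,g₂:ℝ×ℝᵈ→ℝ be L-Lipschitz functions. Then the following are equivalent: (a) there exists a constant C>0 such that for all y,y′∈ℝ and z,z′∈ℝᵈ: −4·y⁻·(g₁(y⁺+y′,z) − g₂(y′,z′)) ≤ 2·1_{{y<0}}|z−z′|² + C(y⁻)²; (b) g₁(y,z) ≥ g₂(y,z) for all y∈ℝ and z∈ℝᵈ. -/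
theorem one_dim_bsvp_iff (d : ℕ) (hd : 1 ≤ d) (L : ℝ) (hL : 0 ≤ L)
    (g₁ g₂ : ℝ → (Fin d → ℝ) → ℝ)
    (hLip₁ : ∀ (y y' : ℝ) (z z' : Fin d → ℝ),
      |g₁ y z - g₁ y' z'| ≤ L * (|y - y'| + Real.sqrt (∑ j, (z j - z' j) ^ 2)))
    (hLip₂ : ∀ (y y' : ℝ) (z z' : Fin d → ℝ),
      |g₂ y z - g₂ y' z'| ≤ L * (|y - y'| + Real.sqrt (∑ j, (z j - z' j) ^ 2))) :
    (∃ C : ℝ, 0 < C ∧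
      ∀ (y y' : ℝ) (z z' : Fin d → ℝ),
        -4 * max (-y) 0 * (g₁ (max y 0 + y') z - g₂ y' z') ≤
          2 * (if y < 0 then (1 : ℝ) else 0) * (∑ j, (z j - z' j) ^ 2) +
            C * (max (-y) 0) ^ 2) ↔
    (∀ (y : ℝ) (z : Fin d → ℝ), g₂ y z ≤ g₁ y z) := by
  constructor
  · rintro ⟨C, hC, h⟩ y z
    by_contra! hlt
    obtain ⟨δ, hδ⟩ : ∃ δ, δ = g₂ y z - g₁ y z := ⟨_, rfl⟩
    have hδ_pos : 0 < δ := by linarith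
    have ht : 0 < δ / C := div_pos hδ_pos hC
    have key := h (-(δ / C)) y z z
    rw [neg_neg, max_eq_left ht.le, max_eq_right (by linarith : -(δ / C) ≤ 0), zero_add,
      (by linarith : g₁ y z - g₂ y z = -δ)] at key
    have hCt : C * (δ / C) ^ 2 = δ / C * δ := by field_simp
    simp only [sub_self, ne_eq, OfNat.ofNat_ne_zero, not_false_eq_true, zero_pow,
      Finset.sum_const_zero, mul_zero, zero_add, hCt] at key
    nlinarith [mul_pos ht hδ_pos]
  · intro h
    refine ⟨2 * L ^ 2 + 1, by positivity, fun y y' z z' => ?_⟩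
    rcases lt_or_ge y 0 with hy | hy
    · rw [max_eq_left (by linarith : (0 : ℝ) ≤ -y), max_eq_right hy.le, zero_add, if_pos hy]
      have hsq := Real.sq_sqrt (Finset.sum_nonneg fun j (_ : j ∈ Finset.univ) =>
        sq_nonneg (z j - z' j))
      have hlip := (abs_le.mp (hLip₂ y' y' z z')).1
      rw [sub_self, abs_zero, zero_add] at hlip
      rw [← hsq]
      set S := Real.sqrt (∑ j, (z j - z' j) ^ 2)
      have hdiff : 0 ≤ g₁ y' z - g₂ y' z' + L * S := by linarith [h y' z]
      nlinarith [mul_nonneg (neg_nonneg.mpr hy.le) hdiff, sq_nonneg (S - L * -y), sq_nonneg y]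
    · simp [max_eq_right (by linarith : -y ≤ 0), not_lt.mpr hy]
end

section
/- Let d ≥ 1 and L ≥ 0, and let F₁,F₂:ℝ×ℝᵈ×ℝ→ℝ be L-Lipschitz functions. Then the following are equivalent: (a) there exists a constant C>0 such that for all y,y′∈ℝ, z,z′∈ℝᵈ, and θ⁽¹⁾,θ⁽²⁾∈ℝ with θ⁽¹⁾ ≥ θ⁽²⁾: −4·y⁻·(F₁(y⁺+y′,z,θ⁽¹⁾) − F₂(y′,z′,θ⁽²⁾)) ≤ 2·1_{{y<0}}|z−z′|² + C(y⁻)²; (b) F₁(y,z,θ⁽¹⁾) ≥ F₂(y,z,θ⁽²⁾) for all y∈ℝ, z∈ℝᵈ, and θ⁽¹⁾,θ⁽²⁾∈ℝ with θ⁽¹⁾ ≥ θ⁽²⁾. -/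
theorem one_dim_anticipated_bsvp_iff (d : ℕ) (hd : 1 ≤ d) (L : ℝ) (hL : 0 ≤ L)
    (F₁ F₂ : ℝ → (Fin d → ℝ) → ℝ → ℝ)
    (hLip₁ : ∀ (y y' : ℝ) (z z' : Fin d → ℝ) (θ θ' : ℝ),
      |F₁ y z θ - F₁ y' z' θ'| ≤
        L * (|y - y'| + Real.sqrt (∑ j, (z j - z' j) ^ 2) + |θ - θ'|))
    (hLip₂ : ∀ (y y' : ℝ) (z z' : Fin d → ℝ) (θ θ' : ℝ),
      |F₂ y z θ - F₂ y' z' θ'| ≤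
        L * (|y - y'| + Real.sqrt (∑ j, (z j - z' j) ^ 2) + |θ - θ'|)) :
    (∃ C : ℝ, 0 < C ∧
      ∀ (y y' : ℝ) (z z' : Fin d → ℝ) (θ₁ θ₂ : ℝ), θ₂ ≤ θ₁ →
        -4 * max (-y) 0 * (F₁ (max y 0 + y') z θ₁ - F₂ y' z' θ₂) ≤
          2 * (if y < 0 then (1 : ℝ) else 0) * (∑ j, (z j - z' j) ^ 2) +
            C * (max (-y) 0) ^ 2) ↔
    (∀ (y : ℝ) (z : Fin d → ℝ) (θ₁ θ₂ : ℝ), θ₂ ≤ θ₁ → F₂ y z θ₂ ≤ F₁ y z θ₁) := by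
  constructor
  · rintro ⟨C, hC, h⟩ y z θ₁ θ₂ hθ
    by_contra! hlt
    set D := F₂ y z θ₂ - F₁ y z θ₁ with hD
    have hDpos : 0 < D := sub_pos.mpr hlt
    have ht : 0 < D / C := div_pos hDpos hC
    have key := h (-(D / C)) y z z θ₁ θ₂ hθ
    have hmax : max (-(D / C)) 0 = 0 := max_eq_right (by linarith)
    rw [neg_neg, max_eq_left ht.le, hmax, zero_add] at key
    simp only [sub_self, ne_eq, OfNat.ofNat_ne_zero, not_false_eq_true, zero_pow,
      Finset.sum_const_zero, mul_zero, zero_add] at key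
    have hCD : C * (D / C) ^ 2 = D / C * D := by field_simp
    rw [hCD, ← neg_sub (F₂ y z θ₂), ← hD] at key
    nlinarith [mul_pos ht hDpos]
  · intro h
    refine ⟨2 * L ^ 2 + 1, by positivity, fun y y' z z' θ₁ θ₂ hθ => ?_⟩
    rcases lt_or_ge y 0 with hy | hy
    · rw [max_eq_left (by linarith : (0 : ℝ) ≤ -y), max_eq_right hy.le, if_pos hy, zero_add]
      have hS : 0 ≤ ∑ j, (z j - z' j) ^ 2 := Finset.sum_nonneg fun j _ => sq_nonneg _
      have hlip := (abs_le.mp (hLip₁ y' y' z z' θ₁ θ₁)).1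
      simp only [sub_self, abs_zero, zero_add, add_zero] at hlip
      have hcomp := h y' z' θ₁ θ₂ hθ
      have hsq := Real.sq_sqrt hS
      set s := Real.sqrt (∑ j, (z j - z' j) ^ 2)
      rw [← hsq]
      have hdiff : 0 ≤ F₁ y' z θ₁ - F₂ y' z' θ₂ + L * s := by linarith
      nlinarith [mul_nonneg (neg_pos.mpr hy).le hdiff, sq_nonneg (s - L * (-y)), sq_nonneg y]
    · rw [max_eq_right (by linarith : -y ≤ 0), if_neg hy.not_gt]
      simp
end
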